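/- arXiv:1608.00926 — 2 statements merged into one kernel-verified Lean document; each statement's English description precedes it below -/
import Mathlib

section
/- Suppose R is noetherian in codimension 1, with witnessing depiction S, and set T := ⋂_{n ∈ U_{S/R}} S_n ⊆ Frac(R). Then T is finitely generated as an S-module and finitely generated as a k-algebra. -/
/-! Common framework: depictions of nonnoetherian integral domains (Beil).
`K` plays the role of the fraction field `Frac R`; all rings are `k`-subalgebras of `K`. -/

section Depictions

variable {k K : Type*} [Field k] [Field K] [Algebra k K]

/-- The localization `A_p` of a subalgebra `A ⊆ K` at a prime ideal `p`,
viewed as a subalgebra of `K`. -/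
def locAt (A : Subalgebra k K) (p : Ideal A) (hp : p.IsPrime) : Subalgebra k K where
  carrier := {x : K | ∃ a s : A, s ∉ p ∧ x * (s : K) = (a : K)}
  one_mem' := ⟨1, 1, (Ideal.ne_top_iff_one p).mp hp.ne_top, by simp⟩
  zero_mem' := ⟨0, 1, (Ideal.ne_top_iff_one p).mp hp.ne_top, by simp⟩
  mul_mem' := by
    rintro x y ⟨a, s, hs, hx⟩ ⟨b, t, ht, hy⟩
    refine ⟨a * b, s * t, fun h => ((hp.mem_or_mem h).elim hs ht), ?_⟩
    have : x * y * ((s : K) * (t : K)) = (x * s) * (y * t) := by ring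
    push_cast
    rw [this, hx, hy]
  add_mem' := by
    rintro x y ⟨a, s, hs, hx⟩ ⟨b, t, ht, hy⟩
    refine ⟨a * t + b * s, s * t, fun h => ((hp.mem_or_mem h).elim hs ht), ?_⟩
    have : (x + y) * ((s : K) * (t : K)) = (x * s) * t + (y * t) * s := by ring
    push_cast
    rw [this, hx, hy]
  algebraMap_mem' := fun c =>
    ⟨algebraMap k A c, 1, (Ideal.ne_top_iff_one p).mp hp.ne_top, by simp⟩

lemma mem_locAt {A : Subalgebra k K} {p : Ideal A} {hp : p.IsPrime} {x : K} :
    x ∈ locAt A p hp ↔ ∃ a s : A, s ∉ p ∧ x * (s : K) = (a : K) := Iff.rfl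

/-- `n ∈ U_{S/R}`: `n` is a maximal ideal of `S` with `R_{n ∩ R} = S_n`. -/
def memU (R S : Subalgebra k K) (h : R ≤ S) (n : Ideal S) : Prop :=
  ∃ hn : n.IsMaximal,
    locAt R (n.comap (Subalgebra.inclusion h)) (hn.isPrime.comap _) = locAt S n hn.isPrime

/-- `q ∈ Z_{S/R}`: `q` is a prime of `S` whose zero locus meets `U_{S/R}`,
i.e. some `n ∈ U_{S/R}` contains `q`. -/
def memZ (R S : Subalgebra k K) (h : R ≤ S) (q : Ideal S) : Prop :=
  q.IsPrime ∧ ∃ n : Ideal S, memU R S h n ∧ q ≤ n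

/-- `S` is a depiction of `R`. -/
structure IsDepiction (R S : Subalgebra k K) : Prop where
  le : R ≤ S
  fg : S.FG
  specSurj : ∀ p : Ideal R, p.IsPrime →
    ∃ q : Ideal S, q.IsPrime ∧ q.comap (Subalgebra.inclusion le) = p
  memU_iff : ∀ (n : Ideal S) (hn : n.IsMaximal),
    memU R S le n ↔
      IsNoetherianRing (locAt R (n.comap (Subalgebra.inclusion le)) (hn.isPrime.comap _))
  nonempty : ∃ n : Ideal S, memU R S le n

/-- The height of an ideal `q`, as the Krull dimension of the set of primes contained in `q`. -/
noncomputable def htOf {A : Type*} [CommRing A] (q : Ideal A) : WithBot ℕ∞ :=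
  Order.krullDim {p : PrimeSpectrum A // p.asIdeal ≤ q}

/-- The geometric height of a prime `p` of `R`: the minimum of the heights `ht_S q` over all
depictions `S` of `R` and primes `q` of `S` with `q ∩ R = p`. -/
noncomputable def ght (R : Subalgebra k K) (p : Ideal R) : WithBot ℕ∞ :=
  sInf {h | ∃ (S : Subalgebra k K) (hd : IsDepiction R S) (q : Ideal S),
    q.IsPrime ∧ q.comap (Subalgebra.inclusion hd.le) = p ∧ h = htOf q}

/-- The geometric dimension of a prime `p` of `R`: `gdim p = dim R - ght p`. -/
noncomputable def gdim (R : Subalgebra k K) (p : Ideal R) : WithBot ℕ∞ :=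
  Option.map₂ (· - ·) (ringKrullDim ↥R) (ght R p)

/-- `T := ⋂_{n ∈ U_{S/R}} S_n`, as a subalgebra of `K`. -/
noncomputable def depT (R S : Subalgebra k K) (h : R ≤ S) : Subalgebra k K :=
  sInf {L | ∃ (n : Ideal S) (hn : n.IsMaximal), memU R S h n ∧ L = locAt S n hn.isPrime}

lemma le_depT (R S : Subalgebra k K) (h : R ≤ S) : S ≤ depT R S h := by
  refine le_sInf ?_
  rintro L ⟨n, hn, -, rfl⟩
  intro x hx
  exact ⟨⟨x, hx⟩, 1, (Ideal.ne_top_iff_one n).mp hn.ne_top, by simp⟩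

/-- A depiction `S` of `R` witnesses `noetherian in codimension 1`:
every height 1 prime of `S` lies in `Z_{S/R}`. -/
def Witnessing (R S : Subalgebra k K) (h : R ≤ S) : Prop :=
  ∀ q : Ideal S, q.IsPrime → htOf q = 1 → memZ R S h q

/-- `R` is noetherian in codimension 1. -/
def NoethCodimOne (R : Subalgebra k K) : Prop :=
  ∃ (S : Subalgebra k K) (hd : IsDepiction R S), Witnessing R S hd.le

/-- A depiction `S` of `R` is saturated if `ght (q ∩ R) = ht_S q` for every prime `q` of `S`
minimal over `(q ∩ R)S`. -/
def IsSaturated (R S : Subalgebra k K) (h : R ≤ S) : Prop :=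
  ∀ q : Ideal S,
    q ∈ (Ideal.map (Subalgebra.inclusion h) (q.comap (Subalgebra.inclusion h))).minimalPrimes →
      ght R (q.comap (Subalgebra.inclusion h)) = htOf q

/-- The subalgebra `k + p ⊆ K`, for `p` an ideal of a subalgebra `S ⊆ K`. -/
def kPlus (S : Subalgebra k K) (p : Ideal S) : Subalgebra k K where
  carrier := {x : K | ∃ (c : k) (f : S), f ∈ p ∧ x = algebraMap k K c + (f : K)}
  one_mem' := ⟨1, 0, p.zero_mem, by simp⟩
  zero_mem' := ⟨0, 0, p.zero_mem, by simp⟩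
  mul_mem' := by
    rintro x y ⟨c, f, hf, rfl⟩ ⟨d, g, hg, rfl⟩
    refine ⟨c * d, algebraMap k S c * g + algebraMap k S d * f + f * g,
      add_mem (add_mem (p.mul_mem_left _ hg) (p.mul_mem_left _ hf)) (p.mul_mem_left _ hg),
      ?_⟩
    push_cast
    ring
  add_mem' := by
    rintro x y ⟨c, f, hf, rfl⟩ ⟨d, g, hg, rfl⟩
    exact ⟨c + d, f + g, add_mem hf hg, by push_cast; ring⟩
  algebraMap_mem' := fun c => ⟨c, 0, p.zero_mem, by simp⟩

lemma kPlus_le (S : Subalgebra k K) (p : Ideal S) : kPlus S p ≤ S := by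
  rintro x ⟨c, f, hf, rfl⟩
  exact add_mem (S.algebraMap_mem c) f.2

end Depictions

open scoped nonZeroDivisors in
/-- In the fraction field of a factorial domain, an element lying in the localization at every
prime element lies in the domain itself. -/
lemma UniqueFactorizationMonoid.isInteger_of_forall_prime {A L : Type*} [CommRing A] [IsDomain A]
    [UniqueFactorizationMonoid A] [Field L] [Algebra A L] [IsFractionRing A L] {x : L}
    (h : ∀ p : A, Prime p → ∃ s : A, ¬ p ∣ s ∧ IsLocalization.IsInteger A (s • x)) :
    IsLocalization.IsInteger A x := by
  obtain ⟨a, b, hab, rfl⟩ := IsFractionRing.exists_reduced_fraction (A := A) x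
  by_cases hb : IsUnit (b : A)
  · obtain ⟨c, hc⟩ := hb.exists_left_inv
    refine ⟨c * a, ?_⟩
    rw [IsLocalization.eq_mk'_iff_mul_eq, ← map_mul]
    congr 1
    linear_combination a * hc
  · exfalso
    obtain ⟨p, hp, hpb⟩ := WfDvdMonoid.exists_irreducible_factor hb (nonZeroDivisors.ne_zero b.2)
    have hp' := UniqueFactorizationMonoid.irreducible_iff_prime.mp hp
    obtain ⟨s, hs, c, hc⟩ := h p hp'
    have hc' : c * b = s * a := by
      apply IsFractionRing.injective A L
      rw [map_mul, map_mul, hc, Algebra.smul_def, mul_assoc, IsLocalization.mk'_spec]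
    rcases hp'.dvd_or_dvd (hc' ▸ hpb.mul_left c) with h1 | h1
    · exact hs h1
    · exact hp.not_isUnit (hab h1 hpb)

open scoped nonZeroDivisors in
/-- Let `S` be a domain finite over a noetherian factorial domain `A`, with fraction field `K`.
An `A`-submodule of `K` contained in the localization of `S` at every prime element of `A` is
finitely generated over `A`. -/
lemma Submodule.fg_of_forall_prime_exists_smul_mem {A S K : Type*} [CommRing A] [IsDomain A]
    [UniqueFactorizationMonoid A] [IsNoetherianRing A] [CommRing S] [IsDomain S] [Field K]
    [Algebra A S] [Algebra S K] [Algebra A K] [IsScalarTower A S K] [Module.Finite A S]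
    [FaithfulSMul A S] [IsFractionRing S K] (T : Submodule A K)
    (hT : ∀ x ∈ T, ∀ p : A, Prime p → ∃ s : A, ¬ p ∣ s ∧ ∃ y : S, s • x = algebraMap S K y) :
    T.FG := by
  have hinj : Function.Injective (algebraMap A K) := by
    rw [IsScalarTower.algebraMap_eq A S K]
    exact (IsFractionRing.injective S K).comp (FaithfulSMul.algebraMap_injective A S)
  have : FaithfulSMul A K := (faithfulSMul_iff_algebraMap_injective A K).mpr hinj
  let : Algebra (FractionRing A) K := FractionRing.liftAlgebra A K
  have : IsScalarTower A (FractionRing A) K := FractionRing.isScalarTower_liftAlgebra A K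
  have : Module.Finite (FractionRing A) K := .of_isLocalization A S A⁰
  let b := Module.finBasis (FractionRing A) K
  obtain ⟨G, hG⟩ := (Module.Finite.fg_top : (⊤ : Submodule A S).FG)
  obtain ⟨a, ha⟩ := IsLocalization.exist_integer_multiples_of_finite A⁰
    (fun z : G × Fin (Module.finrank (FractionRing A) K) => b.repr (algebraMap S K z.1) z.2)
  have ha0 : (algebraMap A (FractionRing A) a) ≠ 0 :=
    IsFractionRing.to_map_ne_zero_of_mem_nonZeroDivisors a.2
  have hrepr (s : A) (x : K) i : b.repr (s • x) i = s • b.repr x i := by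
    rw [← algebraMap_smul (FractionRing A) s x, map_smul, Finsupp.smul_apply, algebraMap_smul]
  have haS (y : S) i : IsLocalization.IsInteger A ((a : A) • b.repr (algebraMap S K y) i) := by
    have hy : y ∈ Submodule.span A (G : Set S) := hG ▸ Submodule.mem_top
    induction hy using Submodule.span_induction with
    | mem y hy => exact ha (⟨y, hy⟩, i)
    | zero => simpa using IsLocalization.isInteger_zero
    | add y z _ _ hy hz =>
      rw [map_add, map_add, Finsupp.add_apply, smul_add]
      exact IsLocalization.isInteger_add hy hz
    | smul c y _ hy =>
      rw [Algebra.algebraMap_eq_smul_one, smul_assoc, ← Algebra.algebraMap_eq_smul_one, hrepr,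
        smul_comm]
      exact IsLocalization.isInteger_smul hy
  have hint (x : K) (hx : x ∈ T) i : IsLocalization.IsInteger A ((a : A) • b.repr x i) := by
    refine UniqueFactorizationMonoid.isInteger_of_forall_prime fun p hp => ?_
    obtain ⟨s, hs, y, hy⟩ := hT x hx p hp
    refine ⟨s, hs, ?_⟩
    rw [smul_comm, ← hrepr, hy]
    exact haS y i
  refine Submodule.FG.of_le (Submodule.fg_span
    (Set.finite_range fun i => (algebraMap A (FractionRing A) a)⁻¹ • b i)) fun x hx => ?_
  rw [← b.sum_repr x]
  refine Submodule.sum_mem _ fun i _ => ?_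
  obtain ⟨c, hc⟩ := hint x hx i
  have : b.repr x i • b i = c • (algebraMap A (FractionRing A) a)⁻¹ • b i := by
    rw [← algebraMap_smul (FractionRing A) c, hc, smul_smul,
      Algebra.smul_def (a : A) (b.repr x i), mul_right_comm, mul_inv_cancel₀ ha0, one_mul]
  rw [this]
  exact Submodule.smul_mem _ _ (Submodule.subset_span ⟨i, rfl⟩)

/-- In a factorial domain, a prime ideal strictly contained in the ideal generated by a prime
element is zero. -/
lemma Ideal.eq_bot_of_lt_span_singleton {A : Type*} [CommRing A] [IsDomain A]
    [UniqueFactorizationMonoid A] {p : Ideal A} [p.IsPrime] {x : A} (hx : Prime x)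
    (h : p < Ideal.span {x}) : p = ⊥ := by
  by_contra hp
  obtain ⟨y, hy, hy0⟩ := Submodule.exists_mem_ne_zero_of_ne_bot hp
  have hxp : x ∉ p := fun hxp => h.not_ge ((Ideal.span_singleton_le_iff_mem p).mpr hxp)
  obtain ⟨n, c, hc, rfl⟩ := WfDvdMonoid.max_power_factor hy0 hx.irreducible
  rcases ‹p.IsPrime›.mem_or_mem hy with h1 | h1
  · exact hxp (‹p.IsPrime›.mem_of_pow_mem n h1)
  · exact hc (Ideal.mem_span_singleton.mp (h.le h1))

/-- A nonzero prime of a domain with no nonzero prime strictly below it has height one. -/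
lemma htOf_eq_one {S : Type*} [CommRing S] [IsDomain S] {q : Ideal S} (hq : q.IsPrime)
    (hq0 : q ≠ ⊥) (h : ∀ p : Ideal S, p.IsPrime → p < q → p = ⊥) : htOf q = 1 := by
  refine le_antisymm (Order.krullDim_le_one_iff.mpr fun p => ?_) (Order.one_le_krullDim_iff.mpr
    ⟨⟨⟨⊥, Ideal.isPrime_bot⟩, bot_le⟩, ⟨⟨q, hq⟩, le_rfl⟩, ?_⟩)
  · rcases eq_or_lt_of_le p.2 with hp | hp
    · exact Or.inr fun r _ => show r.1.asIdeal ≤ p.1.asIdeal from hp.symm ▸ r.2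
    · refine Or.inl fun r _ => show p.1.asIdeal ≤ r.1.asIdeal from ?_
      rw [h _ p.1.2 hp]
      exact bot_le
  · exact show (⊥ : Ideal S) < q from bot_lt_iff_ne_bot.mpr hq0

/-- A prime lying over the ideal generated by a prime element of a factorial domain, in an integral
extension, has height one. -/
lemma htOf_eq_one_of_comap_eq_span_singleton {A S : Type*} [CommRing A] [IsDomain A]
    [UniqueFactorizationMonoid A] [CommRing S] [IsDomain S] [Algebra A S] [FaithfulSMul A S]
    [Algebra.IsIntegral A S] {q : Ideal S} (hq : q.IsPrime) {x : A} (hx : Prime x)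
    (h : q.comap (algebraMap A S) = Ideal.span {x}) : htOf q = 1 := by
  refine htOf_eq_one hq ?_ fun p hp hpq => ?_
  · rintro rfl
    refine hx.ne_zero (FaithfulSMul.algebraMap_injective A S ?_)
    have : x ∈ (⊥ : Ideal S).comap (algebraMap A S) := h ▸ Ideal.mem_span_singleton_self x
    simpa using this
  · have hlt := Ideal.IsIntegral.comap_lt_comap (R := A) hpq
    rw [h] at hlt
    exact Ideal.eq_bot_of_comap_eq_bot (R := A) (Ideal.eq_bot_of_lt_span_singleton hx hlt)

/-- A subalgebra that is finitely generated as a module over a finitely generated subalgebra is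
finitely generated. -/
lemma Subalgebra.FG.of_coe_span_eq {k K : Type*} [Field k] [Field K] [Algebra k K]
    {S T : Subalgebra k K} (hS : S.FG) (hST : S ≤ T) (t : Finset K)
    (ht : (Submodule.span S (t : Set K) : Set K) = T) : T.FG := by
  classical
  obtain ⟨s, rfl⟩ := hS
  refine ⟨s ∪ t, le_antisymm (Algebra.adjoin_le ?_) fun x hx => ?_⟩
  · rw [Finset.coe_union, Set.union_subset_iff]
    exact ⟨Algebra.subset_adjoin.trans hST, ht ▸ Submodule.subset_span⟩
  · rw [← SetLike.mem_coe, ← ht] at hx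
    rw [Finset.coe_union]
    induction hx using Submodule.span_induction with
    | mem x hx => exact Algebra.subset_adjoin (Or.inr hx)
    | zero => exact zero_mem _
    | add x y _ _ hx hy => exact add_mem hx hy
    | smul c x _ hx =>
      exact mul_mem (Algebra.adjoin_mono Set.subset_union_left c.2) hx

/-- If every height one prime of `S` lies in `Z_{S/R}`, then the denominators in `S` of an element
of `T` are not all contained in a height one prime. -/
lemma Witnessing.exists_notMem_mul_mem {k K : Type*} [Field k] [Field K] [Algebra k K]
    {R S : Subalgebra k K} {h : R ≤ S} (hw : Witnessing R S h) {x : K} (hx : x ∈ depT R S h)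
    {q : Ideal S} (hq : q.IsPrime) (hq1 : htOf q = 1) : ∃ s : S, s ∉ q ∧ x * (s : K) ∈ S := by
  obtain ⟨-, n, hn, hqn⟩ := hw q hq hq1
  have hxn : x ∈ locAt S n hn.1.isPrime :=
    (Algebra.mem_sInf.mp hx) _ ⟨n, hn.1, hn, rfl⟩
  obtain ⟨a, s, hs, e⟩ := mem_locAt.mp hxn
  exact ⟨s, fun hsq => hs (hqn hsq), e ▸ a.2⟩

/-- If `R` is noetherian in codimension 1 with witnessing depiction `S` and
`T := ⋂_{n ∈ U_{S/R}} S_n`, then `T` is a finitely generated `S`-module and a finitely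
generated `k`-algebra. -/
theorem depT_module_finite_and_fg (k K : Type*) [Field k] [IsAlgClosed k] [Field K] [Algebra k K]
    (R : Subalgebra k K) (hfrac : IsFractionRing ↥R K)
    (S : Subalgebra k K) (hS : IsDepiction R S) (hw : Witnessing R S hS.le) :
    (∃ t : Finset K, (Submodule.span ↥S (↑t : Set K) : Set K) = (depT R S hS.le : Set K)) ∧
      (depT R S hS.le).FG := by
  have hT : ∃ t : Finset K,
      (Submodule.span ↥S (↑t : Set K) : Set K) = (depT R S hS.le : Set K) := by
    have : IsFractionRing S K := by
      refine IsFractionRing.of_field S K fun z => ?_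
      obtain ⟨x, y, -, rfl⟩ := IsFractionRing.div_surjective R z
      exact ⟨⟨x, hS.le x.2⟩, ⟨y, hS.le y.2⟩, rfl⟩
    have : Algebra.FiniteType k S := S.fg_iff_finiteType.mp hS.fg
    obtain ⟨d, g, hg, hfin⟩ := exists_finite_inj_algHom_of_fg k S
    let : Algebra (MvPolynomial (Fin d) k) S := g.toRingHom.toAlgebra
    let : Algebra (MvPolynomial (Fin d) k) K :=
      ((algebraMap S K).comp (algebraMap (MvPolynomial (Fin d) k) S)).toAlgebra
    have : IsScalarTower (MvPolynomial (Fin d) k) S K := .of_algebraMap_eq fun _ => rfl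
    have : Module.Finite (MvPolynomial (Fin d) k) S := hfin
    have : FaithfulSMul (MvPolynomial (Fin d) k) S :=
      (faithfulSMul_iff_algebraMap_injective _ _).mpr hg
    let T : Submodule S K :=
      { carrier := depT R S hS.le
        add_mem' := add_mem
        zero_mem' := zero_mem _
        smul_mem' := fun c x hx => mul_mem (le_depT R S hS.le c.2) hx }
    have hTfg : (T.restrictScalars (MvPolynomial (Fin d) k)).FG := by
      refine Submodule.fg_of_forall_prime_exists_smul_mem (S := S) _ fun x hx p hp => ?_
      by_contra! hcon
      let D : Ideal S :=
        { carrier := {s | x * (s : K) ∈ S}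
          add_mem' := fun {a b} ha hb => by
            simpa [mul_add] using add_mem ha hb
          zero_mem' := by simp
          smul_mem' := fun c a ha => by
            simpa [mul_left_comm] using mul_mem c.2 ha }
      have hprime : (Ideal.span {p}).IsPrime := (Ideal.span_singleton_prime hp.ne_zero).mpr hp
      have hD : D.comap (algebraMap (MvPolynomial (Fin d) k) S) ≤ Ideal.span {p} := by
        intro s hs
        rw [Ideal.mem_span_singleton]
        by_contra hps
        refine hcon s hps ⟨_, hs⟩ ?_
        rw [Algebra.smul_def, mul_comm]
        rfl
      obtain ⟨q, hDq, hq, hqp⟩ := Ideal.exists_ideal_over_prime_of_isIntegral _ D hD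
      obtain ⟨s, hs, hsx⟩ := hw.exists_notMem_mul_mem hx hq
        (htOf_eq_one_of_comap_eq_span_singleton hq hp hqp)
      exact hs (hDq hsx)
    obtain ⟨t, ht⟩ := Submodule.FG.of_restrictScalars _ hTfg
    exact ⟨t, congrArg SetLike.coe ht⟩
  obtain ⟨t, ht⟩ := hT
  exact ⟨⟨t, ht⟩, hS.fg.of_coe_span_eq (le_depT R S hS.le) t ht⟩
end

section
/- Let S = k[x,y] be a polynomial ring in two variables over an algebraically closed field k, let p := x·(x−1, y)·S (the product of the ideal generated by x and the ideal generated by x−1 and y), let R := k + p, and let T := k[x, x^{-1}, y] ⊆ Frac(R) = k(x,y). Then T is a depiction of R and every depiction of R is contained in T; that is, T is the unique maximal depiction of R. -/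
section Localization

variable {k K : Type*} [Field k] [Field K] [Algebra k K]

lemma le_locAt (A : Subalgebra k K) (P : Ideal A) (hP : P.IsPrime) : A ≤ locAt A P hP :=
  fun x hx => ⟨⟨x, hx⟩, 1, (Ideal.ne_top_iff_one P).mp hP.ne_top, by simp⟩

lemma locAt_congr {A : Subalgebra k K} {P Q : Ideal A} (hP : P.IsPrime) (hQ : Q.IsPrime)
    (h : P = Q) : locAt A P hP = locAt A Q hQ := by
  subst h; rfl

noncomputable instance (A : Subalgebra k K) (P : Ideal A) (hP : P.IsPrime) :
    Algebra A (locAt A P hP) :=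
  (Subalgebra.inclusion (le_locAt A P hP)).toRingHom.toAlgebra

lemma coe_algebraMap_locAt (A : Subalgebra k K) (P : Ideal A) (hP : P.IsPrime) (a : A) :
    (algebraMap A (locAt A P hP) a : K) = a := rfl

instance (A : Subalgebra k K) (P : Ideal A) (hP : P.IsPrime) :
    IsScalarTower A (locAt A P hP) K :=
  IsScalarTower.of_algebraMap_eq fun _ => rfl

lemma coe_ne_zero_of_notMem {A : Subalgebra k K} {P : Ideal A} {s : A} (hs : s ∉ P) :
    (s : K) ≠ 0 := by
  intro h
  exact hs ((Subtype.ext h : s = 0) ▸ P.zero_mem)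

instance (A : Subalgebra k K) (P : Ideal A) (hP : P.IsPrime) :
    IsLocalization.AtPrime (locAt A P hP) P where
  map_units s := by
    have hs := coe_ne_zero_of_notMem (P := P) s.2
    refine IsUnit.of_mul_eq_one
      ⟨(s : K)⁻¹, 1, (s : A), s.2, by simp [hs]⟩ (Subtype.ext ?_)
    simp [coe_algebraMap_locAt, hs]
  surj z := by
    obtain ⟨z, a, s, hs, h⟩ := z
    exact ⟨(a, ⟨s, hs⟩), Subtype.ext h⟩
  exists_of_eq {a b} h := ⟨1, by
    have : (a : K) = b := congrArg (fun z : locAt A P hP => (z : K)) h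
    simp [Subtype.ext this]⟩

lemma isNoetherianRing_locAt {A : Subalgebra k K} (hA : IsNoetherianRing A) (P : Ideal A)
    (hP : P.IsPrime) : IsNoetherianRing (locAt A P hP) :=
  IsLocalization.isNoetherianRing P.primeCompl _ hA

/-- If `T` lies between `R` and `R_{n ∩ R}`, then `R_{n ∩ R} = T_n`. -/
lemma locAt_comap_eq {R T : Subalgebra k K} (h : R ≤ T) (n : Ideal T) (hn : n.IsPrime)
    (hT : T ≤ locAt R (n.comap (Subalgebra.inclusion h)) (hn.comap _)) :
    locAt R (n.comap (Subalgebra.inclusion h)) (hn.comap _) = locAt T n hn := by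
  apply le_antisymm
  · rintro z ⟨a, s, hs, hz⟩
    exact ⟨Subalgebra.inclusion h a, Subalgebra.inclusion h s, hs, hz⟩
  · rintro z ⟨a, s, hs, hz⟩
    obtain ⟨a₁, r₁, hr₁, h₁⟩ := hT a.2
    obtain ⟨a₂, r₂, hr₂, h₂⟩ := hT s.2
    refine ⟨a₁ * r₂, r₁ * a₂, fun hmem => ?_, ?_⟩
    · refine ((hn.comap (Subalgebra.inclusion h)).mem_or_mem hmem).elim hr₁ fun ha₂ => ?_
      have e : s * Subalgebra.inclusion h r₂ = Subalgebra.inclusion h a₂ := Subtype.ext h₂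
      exact (hn.mem_or_mem (e ▸ ha₂ : s * Subalgebra.inclusion h r₂ ∈ n)).elim hs hr₂
    · push_cast
      rw [← h₁, ← h₂, ← hz]
      ring

/-- If `T` lies between `R` and `R_P`, then some prime of `T` lies over `P`. -/
lemma exists_prime_over_of_le_locAt {R T : Subalgebra k K} (h : R ≤ T) (P : Ideal R)
    (hP : P.IsPrime) (hT : T ≤ locAt R P hP) :
    ∃ q : Ideal T, q.IsPrime ∧ q.comap (Subalgebra.inclusion h) = P := by
  have hloc := IsLocalization.AtPrime.isLocalRing (locAt R P hP) P
  refine ⟨(IsLocalRing.maximalIdeal (locAt R P hP)).comap (Subalgebra.inclusion hT),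
    Ideal.IsPrime.comap _, ?_⟩
  rw [Ideal.comap_comapₐ]
  exact IsLocalization.AtPrime.under_maximalIdeal (locAt R P hP) P

/-- If `R_P` is noetherian and `z` stabilizes a nonzero ideal of `R`, then some multiple `m * z`
with `m ∈ R \ P` is integral over `R`. -/
lemma exists_isIntegral_mul_of_locAt_noetherian {R : Subalgebra k K} {P : Ideal R}
    {hP : P.IsPrime} (hnoeth : IsNoetherianRing (locAt R P hP)) {I : Ideal R} (hI : I ≠ ⊥) {z : K}
    (hz : ∀ f ∈ I, ∃ g ∈ I, z * (f : K) = g) :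
    ∃ m : R, m ∉ P ∧ IsIntegral R ((m : K) * z) := by
  let L := locAt R P hP
  let J : Ideal L := I.map (algebraMap R L)
  let N : Submodule L K := Submodule.map (Algebra.linearMap L K) J
  have hmem : ∀ f ∈ I, (f : K) ∈ N := fun f hf =>
    ⟨algebraMap R L f, Ideal.mem_map_of_mem _ hf, rfl⟩
  have hN : N ≠ ⊥ := by
    obtain ⟨f, hf, hf0⟩ := Submodule.exists_mem_ne_zero_of_ne_bot hI
    intro h
    have := hmem f hf
    rw [h, Submodule.mem_bot] at this
    exact hf0 (Subtype.ext this)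
  have hstab : ∀ n ∈ N, z • n ∈ N := by
    rintro _ ⟨j, hj, rfl⟩
    induction hj using Submodule.span_induction with
    | mem j hj =>
      obtain ⟨f, hf, rfl⟩ := hj
      obtain ⟨g, hg, e⟩ := hz f hf
      have := hmem g hg
      rw [← e] at this
      exact this
    | zero => simp
    | add a b _ _ ha hb => rw [map_add, smul_add]; exact N.add_mem ha hb
    | smul c a _ ha => rw [map_smul, smul_comm]; exact N.smul_mem c ha
  have hint : IsIntegral L z := isIntegral_of_smul_mem_submodule N hN
    (Submodule.FG.map _ (Ideal.fg_of_isNoetherianRing J)) z hstab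
  obtain ⟨m, hm⟩ := hint.exists_multiple_integral_of_isLocalization P.primeCompl
  exact ⟨m, m.2, hm⟩

/-- Localizing at a closed point of `S` over which `R` and `S` agree bounds every depiction. -/
lemma IsDepiction.le_locAt {R S S' : Subalgebra k K} (hd : IsDepiction R S') (h : R ≤ S)
    (hS : IsNoetherianRing S) (m : Ideal S) (hm : m.IsPrime)
    (hmax : (m.comap (Subalgebra.inclusion h)).IsMaximal)
    (hle : S ≤ locAt R (m.comap (Subalgebra.inclusion h)) (hm.comap _)) :
    S' ≤ locAt S m hm := by
  have heq := locAt_comap_eq h m hm hle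
  obtain ⟨q, hq, hqP⟩ := hd.specSurj _ (hm.comap (Subalgebra.inclusion h))
  obtain ⟨n, hn, hqn⟩ := q.exists_le_maximal hq.ne_top
  have hP := hmax.eq_of_le (hn.isPrime.comap (Subalgebra.inclusion hd.le)).ne_top
    (hqP ▸ Ideal.comap_mono hqn)
  have hloc := locAt_congr (hm.comap _) (hn.isPrime.comap _) hP
  have hnoeth : IsNoetherianRing (locAt R _ (hn.isPrime.comap (Subalgebra.inclusion hd.le))) := by
    rw [← hloc, heq]
    exact isNoetherianRing_locAt hS m hm
  obtain ⟨_, he⟩ := (hd.memU_iff n hn).mpr hnoeth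
  rw [← heq, hloc, he]
  exact _root_.le_locAt S' n hn.isPrime

/-- An element of `S` taking every value of the infinite field `k`, under homomorphisms `S → k`
with the same restriction to `R`, is not integral over `R`. -/
lemma not_isIntegral_of_forall_exists_hom [Infinite k] {R S : Subalgebra k K} (h : R ≤ S)
    (ψ : R →+* k) (z : S)
    (hφ : ∀ r : k, ∃ φ : S →+* k, φ.comp (Subalgebra.inclusion h).toRingHom = ψ ∧ φ z = r) :
    ¬ IsIntegral R (z : K) := by
  rintro ⟨q, hq, hq0⟩
  have hS : q.eval₂ (Subalgebra.inclusion h).toRingHom z = 0 := by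
    apply Subtype.val_injective
    have := Polynomial.hom_eval₂ q (Subalgebra.inclusion h).toRingHom S.val.toRingHom z
    exact this.trans hq0
  refine (hq.map ψ).ne_zero (Polynomial.funext fun r => ?_)
  obtain ⟨φ, hφ, hz⟩ := hφ r
  rw [Polynomial.eval_map, ← hφ, ← hz, ← Polynomial.hom_eval₂, hS]
  simp

end Localization

section KPlus

variable {k K : Type*} [Field k] [Field K] [Algebra k K]

/-- The ideal `p` of `S`, viewed as an ideal of `k + p`. -/
def kPlusIdeal (S : Subalgebra k K) (p : Ideal S) : Ideal (kPlus S p) :=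
  p.comap (Subalgebra.inclusion (kPlus_le S p))

lemma mem_kPlus_of_mem {S : Subalgebra k K} {p : Ideal S} {f : S} (hf : f ∈ p) :
    (f : K) ∈ kPlus S p :=
  ⟨0, f, hf, by simp⟩

lemma eq_kPlusIdeal_of_le {S : Subalgebra k K} {p : Ideal S} {P : Ideal (kPlus S p)}
    (hP : P ≠ ⊤) (h : kPlusIdeal S p ≤ P) : P = kPlusIdeal S p := by
  refine le_antisymm ?_ h
  rintro ⟨_, c, f, hf, rfl⟩ hr
  have hfP : (⟨f, mem_kPlus_of_mem hf⟩ : kPlus S p) ∈ P := h hf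
  have hc : algebraMap k (kPlus S p) c ∈ P := by
    convert P.sub_mem hr hfP using 1
    exact Subtype.ext (add_sub_cancel_right _ _).symm
  have hc0 : c = 0 := by
    by_contra hc0
    exact hP (P.eq_top_of_isUnit_mem hc ((IsUnit.mk0 c hc0).map _))
  subst hc0
  change (⟨_, _⟩ : S) ∈ p
  convert hf using 1
  exact Subtype.ext (by simp)

lemma exists_notMem_of_ne_kPlusIdeal {S : Subalgebra k K} {p : Ideal S} {P : Ideal (kPlus S p)}
    (hP : P ≠ ⊤) (h : P ≠ kPlusIdeal S p) :
    ∃ (g : S) (hg : g ∈ p), (⟨g, mem_kPlus_of_mem hg⟩ : kPlus S p) ∉ P := by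
  by_contra! hcon
  exact h (eq_kPlusIdeal_of_le hP fun r hr => hcon ⟨r, kPlus_le S p r.2⟩ hr)

lemma le_locAt_kPlus {S : Subalgebra k K} {p : Ideal S} {P : Ideal (kPlus S p)} (hP : P.IsPrime)
    (h : P ≠ kPlusIdeal S p) : S ≤ locAt (kPlus S p) P hP := by
  obtain ⟨g, hg, hgP⟩ := exists_notMem_of_ne_kPlusIdeal hP.ne_top h
  exact fun z hz => ⟨⟨_, mem_kPlus_of_mem (p.mul_mem_left ⟨z, hz⟩ hg)⟩, _, hgP, rfl⟩

/-- Elements dividing `p` become invertible away from `p`. -/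
lemma inv_mem_locAt_kPlus {S : Subalgebra k K} {p : Ideal S} {P : Ideal (kPlus S p)}
    (hP : P.IsPrime) (h : P ≠ kPlusIdeal S p) {x : S} (hx : p ≤ Ideal.span {x}) :
    (x : K)⁻¹ ∈ locAt (kPlus S p) P hP := by
  obtain ⟨g, hg, hgP⟩ := exists_notMem_of_ne_kPlusIdeal hP.ne_top h
  obtain ⟨f, rfl⟩ := Ideal.mem_span_singleton'.mp (hx hg)
  have h0 : (f * x : K) ≠ 0 := coe_ne_zero_of_notMem hgP
  refine ⟨⟨_, mem_kPlus_of_mem (p.mul_mem_left f hg)⟩, _,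
    fun hmem => (hP.mem_or_mem hmem).elim hgP hgP, ?_⟩
  push_cast
  field_simp [right_ne_zero_of_mul h0]

lemma comap_ker_kPlus_isMaximal {S : Subalgebra k K} (p : Ideal S) (φ : S →ₐ[k] k) :
    ((RingHom.ker φ).comap (Subalgebra.inclusion (kPlus_le S p))).IsMaximal := by
  have : (RingHom.ker φ).comap (Subalgebra.inclusion (kPlus_le S p)) =
      RingHom.ker (φ.comp (Subalgebra.inclusion (kPlus_le S p))) := rfl
  rw [this]
  exact RingHom.ker_isMaximal_of_surjective _ fun c => ⟨algebraMap _ _ c, AlgHom.commutes _ c⟩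

lemma comap_ker_kPlus_eq {S : Subalgebra k K} {p : Ideal S} (φ : S →ₐ[k] k)
    (h : p ≤ RingHom.ker φ) :
    (RingHom.ker φ).comap (Subalgebra.inclusion (kPlus_le S p)) = kPlusIdeal S p :=
  eq_kPlusIdeal_of_le (comap_ker_kPlus_isMaximal p φ).ne_top (Ideal.comap_mono h)

end KPlus

section KPlusPrincipal

variable {k K : Type*} [Field k] [Field K] [Algebra k K]

lemma algHom_kPlus_eq {S : Subalgebra k K} {p : Ideal S} {φ φ' : S →ₐ[k] k}
    (h : p ≤ RingHom.ker φ) (h' : p ≤ RingHom.ker φ') (r : kPlus S p) :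
    φ (Subalgebra.inclusion (kPlus_le S p) r) = φ' (Subalgebra.inclusion (kPlus_le S p) r) := by
  obtain ⟨_, c, f, hf, rfl⟩ := r
  have : Subalgebra.inclusion (kPlus_le S p) ⟨algebraMap k K c + f, c, f, hf, rfl⟩ =
      algebraMap k S c + f := rfl
  rw [this, map_add, map_add, AlgHom.commutes, AlgHom.commutes,
    RingHom.mem_ker.mp (h hf), RingHom.mem_ker.mp (h' hf)]

lemma inv_notMem_locAt_kPlusIdeal {S : Subalgebra k K} {p : Ideal S} {φ : S →ₐ[k] k}
    (h : p ≤ RingHom.ker φ) {x : S} (hx0 : x ≠ 0) (hx : φ x = 0) (hp : (kPlusIdeal S p).IsPrime) :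
    (x : K)⁻¹ ∉ locAt (kPlus S p) (kPlusIdeal S p) hp := by
  rintro ⟨a, s, hs, e⟩
  rw [← comap_ker_kPlus_eq φ h] at hs
  refine hs ?_
  have hxK : (x : K) ≠ 0 := fun h0 => hx0 (Subtype.ext h0)
  have es : Subalgebra.inclusion (kPlus_le S p) s =
      x * Subalgebra.inclusion (kPlus_le S p) a := by
    apply Subtype.ext
    change (s : K) = x * a
    rw [← e]
    field_simp
  rw [Ideal.mem_comap, RingHom.mem_ker, es, map_mul, hx, zero_mul]

/-- If `p` vanishes at points of `Spec S` at which `y` takes all values,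
then `k + p` is not noetherian at `p`. -/
lemma not_isNoetherianRing_locAt_kPlusIdeal [Infinite k] {S : Subalgebra k K} {p : Ideal S}
    (hp0 : p ≠ ⊥) (y : S) (hφ : ∀ b : k, ∃ φ : S →ₐ[k] k, p ≤ RingHom.ker φ ∧ φ y = b)
    (hp : (kPlusIdeal S p).IsPrime) :
    ¬ IsNoetherianRing (locAt (kPlus S p) (kPlusIdeal S p) hp) := by
  intro hnoeth
  have hI : kPlusIdeal S p ≠ ⊥ := by
    obtain ⟨f, hf, hf0⟩ := Submodule.exists_mem_ne_zero_of_ne_bot hp0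
    exact (Submodule.ne_bot_iff _).mpr
      ⟨⟨f, mem_kPlus_of_mem hf⟩, hf,
        fun h0 => hf0 (Subtype.ext (congrArg (fun r : kPlus S p => (r : K)) h0))⟩
  obtain ⟨m, hm, hint⟩ := exists_isIntegral_mul_of_locAt_noetherian hnoeth hI (z := y)
    fun f hf => ⟨⟨_, mem_kPlus_of_mem (p.mul_mem_left y hf)⟩, p.mul_mem_left y hf, rfl⟩
  obtain ⟨φ₀, hφ₀, -⟩ := hφ 0
  rw [← comap_ker_kPlus_eq φ₀ hφ₀] at hm
  refine not_isIntegral_of_forall_exists_hom (kPlus_le S p)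
    (φ₀.comp (Subalgebra.inclusion (kPlus_le S p))).toRingHom
    (Subalgebra.inclusion (kPlus_le S p) m * y) (fun r => ?_) hint
  obtain ⟨φ, hφ, hy⟩ := hφ (r / φ₀ (Subalgebra.inclusion (kPlus_le S p) m))
  refine ⟨φ.toRingHom, RingHom.ext fun a => algHom_kPlus_eq hφ hφ₀ a, ?_⟩
  change φ (_ * y) = r
  rw [map_mul, hy, algHom_kPlus_eq hφ hφ₀]
  exact mul_div_cancel₀ r hm

end KPlusPrincipal

section Plane

open MvPolynomial

variable {k K : Type*} [Field k] [Field K] [Algebra k K]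

lemma isRelPrime_X_sub_one_X :
    IsRelPrime (X 0 - 1 : MvPolynomial (Fin 2) k) (X 1) := by
  refine ((X_prime (R := k) (i := (1 : Fin 2))).irreducible.isRelPrime_iff_not_dvd.mpr ?_).symm
  intro h
  have := map_dvd (aeval (![0, 0] : Fin 2 → k)) h
  simp at this

/-- A plane curve having no points with `X 0 ≠ 0`, except possibly `(1, 0)`, is a multiple of the
line `X 0 = 0`. -/
lemma exists_dvd_X_zero_pow [IsAlgClosed k] (g : MvPolynomial (Fin 2) k)
    (hg : ∀ a b : k, a ≠ 0 → ¬(a = 1 ∧ b = 0) → aeval ![a, b] g ≠ 0) :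
    ∃ N : ℕ, g ∣ X 0 ^ N := by
  have key (q : MvPolynomial (Fin 2) k)
      (hq : ∀ a b : k, a = 0 ∨ (a = 1 ∧ b = 0) → aeval ![a, b] q = 0) : ∃ N : ℕ, g ∣ q ^ N := by
    have : q ∈ vanishingIdeal k (zeroLocus k (Ideal.span {g})) := by
      intro v hv
      have hv' := hv g (Ideal.mem_span_singleton_self g)
      have e : v = ![v 0, v 1] := by ext i; fin_cases i <;> rfl
      rw [e] at hv' ⊢
      apply hq
      by_contra! hcon
      exact hg _ _ hcon.1 (fun h => hcon.2 h.1 h.2) hv'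
    rw [vanishingIdeal_zeroLocus_eq_radical] at this
    obtain ⟨N, hN⟩ := this
    exact ⟨N, Ideal.mem_span_singleton.mp hN⟩
  obtain ⟨m, hm⟩ := key (X 0 * (X 0 - 1)) (by
    rintro a b (rfl | ⟨rfl, rfl⟩) <;> simp)
  obtain ⟨n, hn⟩ := key (X 0 * X 1) (by
    rintro a b (rfl | ⟨rfl, rfl⟩) <;> simp)
  let _ := UniqueFactorizationMonoid.toGCDMonoid (MvPolynomial (Fin 2) k)
  refine ⟨m + n, ?_⟩
  have hm' : g ∣ X 0 ^ (m + n) * (X 0 - 1) ^ (m + n) := by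
    rw [← mul_pow]; exact hm.trans (pow_dvd_pow _ (Nat.le_add_right _ _))
  have hn' : g ∣ X 0 ^ (m + n) * X 1 ^ (m + n) := by
    rw [← mul_pow]; exact hn.trans (pow_dvd_pow _ (Nat.le_add_left _ _))
  have hunit : IsUnit (gcd ((X 0 - 1) ^ (m + n)) (X 1 ^ (m + n) : MvPolynomial (Fin 2) k)) :=
    gcd_isUnit_iff_isRelPrime.mpr isRelPrime_X_sub_one_X.pow
  exact hunit.dvd_mul_right.mp ((dvd_gcd hm' hn').trans (gcd_mul_left' _ _ _).dvd)

/-- A rational function on the plane that is regular wherever `x ≠ 0`, except possibly at `(1, 0)`,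
becomes a polynomial after multiplication by a power of `x`. -/
lemma exists_mul_pow_eq_aeval [IsAlgClosed k] {x y : K} (hxy : AlgebraicIndependent k ![x, y])
    {z : K} {f g : MvPolynomial (Fin 2) k} (hg : g ≠ 0)
    (hz : z * aeval ![x, y] g = aeval ![x, y] f)
    (hreg : ∀ a b : k, a ≠ 0 → ¬(a = 1 ∧ b = 0) → ∃ u s : MvPolynomial (Fin 2) k,
      aeval ![a, b] s ≠ 0 ∧ z * aeval ![x, y] s = aeval ![x, y] u) :
    ∃ (N : ℕ) (h : MvPolynomial (Fin 2) k), z * x ^ N = aeval ![x, y] h := by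
  have hinj := algebraicIndependent_iff_injective_aeval.mp hxy
  obtain ⟨f, g, c, hfg, rfl, rfl⟩ := UniqueFactorizationMonoid.exists_reduced_factors' f g hg
  have hc : aeval ![x, y] c ≠ 0 :=
    (map_ne_zero_iff _ hinj).mpr (left_ne_zero_of_mul hg)
  have hz' : z * aeval ![x, y] g = aeval ![x, y] f := by
    apply mul_left_cancel₀ hc
    rw [← map_mul, ← hz, map_mul]
    ring
  obtain ⟨N, h, hN⟩ := exists_dvd_X_zero_pow g (by
    intro a b ha hab hg0
    obtain ⟨u, s, hs, e⟩ := hreg a b ha hab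
    have hfs : f * s = g * u := hinj (by rw [map_mul, map_mul, ← hz', ← e]; ring)
    obtain ⟨t, rfl⟩ := hfg.symm.dvd_of_dvd_mul_left (Dvd.intro u hfs.symm)
    exact hs (by rw [map_mul, hg0, zero_mul]))
  refine ⟨N, f * h, ?_⟩
  have hx : x ^ N = aeval ![x, y] (X 0 ^ N : MvPolynomial (Fin 2) k) := by simp
  rw [hx, hN, map_mul, map_mul, ← mul_assoc, hz']

lemma exists_aeval_eq_of_mem_adjoin {x y s : K} (hs : s ∈ Algebra.adjoin k {x, y}) :
    ∃ q : MvPolynomial (Fin 2) k, aeval ![x, y] q = s := by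
  rwa [← Matrix.range_cons_cons_empty x y ![], Algebra.adjoin_range_eq_range_aeval] at hs

/-- Evaluation of the polynomial ring `k[x, y] ⊆ K` at a point of the plane. -/
lemma exists_algHom_adjoin {x y : K} (hxy : AlgebraicIndependent k ![x, y])
    {S : Subalgebra k K} (hS : S = Algebra.adjoin k {x, y}) (a b : k) :
    ∃ φ : S →ₐ[k] k, ∀ (q : MvPolynomial (Fin 2) k) (hq),
      φ ⟨aeval ![x, y] q, hq⟩ = aeval ![a, b] q := by
  have hrange : S ≤ Algebra.adjoin k (Set.range ![x, y]) := by
    rw [Matrix.range_cons_cons_empty, hS]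
  refine ⟨(aeval ![a, b]).comp (hxy.repr.comp (Subalgebra.inclusion hrange)), fun q hq => ?_⟩
  have hq' : hxy.repr ⟨aeval ![x, y] q, hrange hq⟩ = q :=
    algebraicIndependent_iff_injective_aeval.mp hxy (hxy.aeval_repr _)
  exact congrArg (aeval ![a, b]) hq'

end Plane

/-- With `S = k[x,y]`, `p = x·(x-1,y)·S`, `R = k + p`, and `T = k[x,x⁻¹,y] ⊆ k(x,y)`:
`T` is the unique maximal depiction of `R`. -/
theorem laurent_unique_maximal_depiction (k K : Type*) [Field k] [IsAlgClosed k] [Field K] [Algebra k K]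
    (x y : K) (hxy : AlgebraicIndependent k ![x, y])
    (S : Subalgebra k K) (hSdef : S = Algebra.adjoin k {x, y})
    (hxS : x ∈ S) (hx1S : x - 1 ∈ S) (hyS : y ∈ S)
    (p : Ideal S)
    (hpdef : p = Ideal.span ({⟨x, hxS⟩} : Set S) * Ideal.span ({⟨x - 1, hx1S⟩, ⟨y, hyS⟩} : Set S))
    (R : Subalgebra k K) (hRdef : R = kPlus S p)
    (hfrac : IsFractionRing ↑R K)
    (T : Subalgebra k K) (hTdef : T = Algebra.adjoin k {x, x⁻¹, y}) :
    IsDepiction R T ∧ ∀ S' : Subalgebra k K, IsDepiction R S' → S' ≤ T := by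
  subst hRdef
  set X : S := ⟨x, hxS⟩
  set Y : S := ⟨y, hyS⟩
  have hX1 : (⟨x - 1, hx1S⟩ : S) = X - 1 := rfl
  rw [hX1] at hpdef
  have hx0 : x ≠ 0 := hxy.ne_zero 0
  have hX0 : X ≠ 0 := fun h => hx0 (congrArg (fun s : S => (s : K)) h)
  have hY0 : Y ≠ 0 := fun h => hxy.ne_zero 1 (congrArg (fun s : S => (s : K)) h)
  have hpX : p ≤ Ideal.span {X} := hpdef.trans_le Ideal.mul_le_left
  have hXXp : X * (X - 1) ∈ p := hpdef ▸ Ideal.mul_mem_mul (Ideal.subset_span rfl)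
    (Ideal.subset_span (Or.inl rfl))
  have hXYp : X * Y ∈ p := hpdef ▸ Ideal.mul_mem_mul (Ideal.subset_span rfl)
    (Ideal.subset_span (Or.inr rfl))
  have hp0 : p ≠ ⊥ := (Submodule.ne_bot_iff _).mpr ⟨_, hXYp, mul_ne_zero hX0 hY0⟩
  have hker {φ : S →ₐ[k] k} (h : φ X = 0 ∨ (φ X = 1 ∧ φ Y = 0)) : p ≤ RingHom.ker φ := by
    rcases h with h | ⟨h, h'⟩
    · exact hpX.trans ((Ideal.span_singleton_le_iff_mem _).mpr h)
    · rw [hpdef]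
      refine Ideal.mul_le_right.trans (Ideal.span_le.mpr ?_)
      rintro _ (rfl | rfl)
      · simp [h]
      · exact h'
  choose ev hev using exists_algHom_adjoin hxy hSdef
  have hevX (a b : k) : ev a b X = a := by
    have := hev a b (MvPolynomial.X 0) (by simpa using hxS)
    simpa using this
  have hevY (a b : k) : ev a b Y = b := by
    have := hev a b (MvPolynomial.X 1) (by simpa using hyS)
    simpa using this
  have hcomap_ne {a b : k} (ha : a ≠ 0) (hab : ¬(a = 1 ∧ b = 0)) :
      (RingHom.ker (ev a b)).comap (Subalgebra.inclusion (kPlus_le S p)) ≠ kPlusIdeal S p := by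
    intro h
    have h₁ : (⟨_, mem_kPlus_of_mem hXXp⟩ : kPlus S p) ∈ kPlusIdeal S p := hXXp
    have h₂ : (⟨_, mem_kPlus_of_mem hXYp⟩ : kPlus S p) ∈ kPlusIdeal S p := hXYp
    rw [← h] at h₁ h₂
    replace h₁ : ev a b (X * (X - 1)) = 0 := h₁
    replace h₂ : ev a b (X * Y) = 0 := h₂
    simp only [map_mul, map_sub, map_one, hevX, hevY, mul_eq_zero, ha, false_or, sub_eq_zero]
      at h₁ h₂
    exact hab ⟨h₁, h₂⟩
  have hST : S ≤ T := by
    rw [hSdef, hTdef]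
    exact Algebra.adjoin_mono (by rintro _ (rfl | rfl) <;> simp)
  have hRT : kPlus S p ≤ T := (kPlus_le S p).trans hST
  have hxT : x⁻¹ ∈ T := hTdef ▸ Algebra.subset_adjoin (by simp)
  have hT_le {L : Subalgebra k K} (hSL : S ≤ L) (hxL : x⁻¹ ∈ L) : T ≤ L := by
    rw [hTdef]
    refine Algebra.adjoin_le ?_
    rintro _ (rfl | rfl | rfl)
    exacts [hSL hxS, hxL, hSL hyS]
  have hTloc {P : Ideal (kPlus S p)} (hP : P.IsPrime) (h : P ≠ kPlusIdeal S p) :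
      T ≤ locAt (kPlus S p) P hP :=
    hT_le (le_locAt_kPlus hP h) (inv_mem_locAt_kPlus hP h hpX)
  have hSfg : S.FG := Subalgebra.fg_def.mpr ⟨{x, y}, Set.toFinite _, hSdef.symm⟩
  have hTfg : T.FG := Subalgebra.fg_def.mpr ⟨{x, x⁻¹, y}, Set.toFinite _, hTdef.symm⟩
  have hsurj (P : Ideal (kPlus S p)) (hP : P.IsPrime) :
      ∃ q : Ideal T, q.IsPrime ∧ q.comap (Subalgebra.inclusion hRT) = P := by
    by_cases h : P = kPlusIdeal S p
    · have hm : (RingHom.ker (ev 1 0)).IsPrime := RingHom.ker_isPrime _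
      obtain ⟨q, hq, hqm⟩ := exists_prime_over_of_le_locAt hST _ hm
        (hT_le (le_locAt S _ hm) ⟨1, X, by simp [hevX], by simp [X, hx0]⟩)
      refine ⟨q, hq, ?_⟩
      rw [h, ← comap_ker_kPlus_eq (ev 1 0) (hker (Or.inr ⟨hevX 1 0, hevY 1 0⟩)), ← hqm]
      rfl
    · exact exists_prime_over_of_le_locAt hRT P hP (hTloc hP h)
  have hU (n : Ideal T) (hn : n.IsMaximal)
      (h : n.comap (Subalgebra.inclusion hRT) ≠ kPlusIdeal S p) : memU (kPlus S p) T hRT n :=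
    ⟨hn, locAt_comap_eq hRT n hn.isPrime (hTloc _ h)⟩
  refine ⟨⟨hRT, hTfg, hsurj, fun n hn => ?_, ?_⟩, fun S' hS' => ?_⟩
  · by_cases h : n.comap (Subalgebra.inclusion hRT) = kPlusIdeal S p
    · have hp : (kPlusIdeal S p).IsPrime := h ▸ hn.isPrime.comap _
      have hloc := locAt_congr (hn.isPrime.comap (Subalgebra.inclusion hRT)) hp h
      refine iff_of_false ?_ ?_
      · rintro ⟨_, e⟩
        refine inv_notMem_locAt_kPlusIdeal (hker (Or.inl (hevX 0 0))) hX0 (hevX 0 0) hp ?_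
        rw [← hloc, e]
        exact le_locAt T n _ hxT
      · rw [hloc]
        exact not_isNoetherianRing_locAt_kPlusIdeal hp0 Y
          (fun b => ⟨ev 0 b, hker (Or.inl (hevX 0 b)), hevY 0 b⟩) hp
    · refine iff_of_true (hU n hn h) ?_
      obtain ⟨_, e⟩ := hU n hn h
      rw [e]
      exact isNoetherianRing_locAt (isNoetherianRing_of_fg hTfg) n hn.isPrime
  · have hmax := comap_ker_kPlus_isMaximal p (ev 1 1)
    obtain ⟨q, hq, hqP⟩ := hsurj _ hmax.isPrime
    obtain ⟨n, hn, hqn⟩ := q.exists_le_maximal hq.ne_top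
    refine ⟨n, hU n hn ?_⟩
    rw [← hmax.eq_of_le (hn.isPrime.comap _).ne_top (hqP ▸ Ideal.comap_mono hqn)]
    exact hcomap_ne one_ne_zero (by simp)
  · intro z hz
    obtain ⟨r, s, hs, e⟩ := IsFractionRing.div_surjective (A := kPlus S p) z
    have hs0 : (s : K) ≠ 0 := fun h => nonZeroDivisors.ne_zero hs (Subtype.ext h)
    obtain ⟨f, hf⟩ := exists_aeval_eq_of_mem_adjoin (hSdef.le (kPlus_le S p r.2))
    obtain ⟨g, hg⟩ := exists_aeval_eq_of_mem_adjoin (hSdef.le (kPlus_le S p s.2))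
    have hg0 : g ≠ 0 := by
      rintro rfl
      exact hs0 (by rw [← hg, map_zero])
    obtain ⟨N, h, hN⟩ := exists_mul_pow_eq_aeval hxy hg0
      (by rw [hf, hg, ← e]; exact div_mul_cancel₀ _ hs0) (z := z) (f := f) (by
        intro a b ha hab
        have hm : (RingHom.ker (ev a b)).IsPrime := RingHom.ker_isPrime _
        obtain ⟨⟨u, hu⟩, ⟨t, ht⟩, htm, e⟩ := hS'.le_locAt (kPlus_le S p)
          (isNoetherianRing_of_fg hSfg) _ hm (comap_ker_kPlus_isMaximal p (ev a b))
          (le_locAt_kPlus _ (hcomap_ne ha hab)) hz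
        obtain ⟨u, rfl⟩ := exists_aeval_eq_of_mem_adjoin (hSdef.le hu)
        obtain ⟨t, rfl⟩ := exists_aeval_eq_of_mem_adjoin (hSdef.le ht)
        exact ⟨u, t, fun h0 => htm ((hev a b t ht).trans h0), e⟩)
    have hzN : z = x⁻¹ ^ N * MvPolynomial.aeval ![x, y] h := by
      rw [← hN, inv_pow]
      field_simp
    rw [hzN]
    refine mul_mem (pow_mem hxT N) (hST ?_)
    rw [show S = Algebra.adjoin k (Set.range ![x, y]) by
      rw [Matrix.range_cons_cons_empty, hSdef],
      Algebra.adjoin_range_eq_range_aeval]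
    exact ⟨h, rfl⟩
end
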